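/- There exists a constant d > 0 such that for every prime p with p ≡ 3 (mod 4), every real eigenvalue α of the random-walk kernel A (i.e., every α ∈ ℝ for which there exists a nonzero vector v : F_p → ℝ with A·v = α·v) satisfies α ≥ −1 + d/p. -/

import Mathlib

open Finset

/-- The circle of quadrance `K` centered at the origin in `F_p × F_p`. -/
def circ (p : ℕ) [NeZero p] (K : ZMod p) : Finset (ZMod p × ZMod p) :=
  Finset.univ.filter (fun v => v.1 ^ 2 + v.2 ^ 2 = K)

/-- `N_{ij}^k`: the number of pairs `(a, b)` with `a ∈ C_i`, `b ∈ C_j`, `a + b ∈ C_k`. -/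
def Ncirc (p : ℕ) [NeZero p] (i j k : ZMod p) : ℕ :=
  ((circ p i ×ˢ circ p j).filter (fun ab => ab.1 + ab.2 ∈ circ p k)).card

/-- The random-walk kernel of the unit circle: `A(i,j) = N_{i1}^j / (|C_i|·|C_1|)`. -/
noncomputable def kerA (p : ℕ) [NeZero p] : Matrix (ZMod p) (ZMod p) ℝ :=
  fun i j => (Ncirc p i 1 j : ℝ) / (((circ p i).card : ℝ) * ((circ p 1).card : ℝ))

/-- The stationary distribution: `π(0) = 1/p²`, `π(j) = (p+1)/p²` for `j ≠ 0`. -/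
noncomputable def piDist (p : ℕ) [NeZero p] (j : ZMod p) : ℝ :=
  if j = 0 then 1 / (p : ℝ) ^ 2 else ((p : ℝ) + 1) / (p : ℝ) ^ 2

lemma circ_mem (p : ℕ) [NeZero p] (K : ZMod p) (a : ZMod p × ZMod p) :
    a ∈ circ p K ↔ a.1 ^ 2 + a.2 ^ 2 = K := by
  simp [circ]

lemma sum_sq_zero (p : ℕ) [Fact p.Prime] (hp : p % 4 = 3) (x y : ZMod p)
    (h : x ^ 2 + y ^ 2 = 0) : x = 0 ∧ y = 0 := by
  have hy : y = 0 := by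
    by_contra hy
    have h1 : (x / y) ^ 2 = -1 := by
      field_simp
      linear_combination h
    exact ZMod.mod_four_ne_three_of_sq_eq_neg_one h1 hp
  subst hy
  refine ⟨?_, rfl⟩
  simpa using h

lemma circ_card_zero (p : ℕ) [Fact p.Prime] (hp : p % 4 = 3) : circ p 0 = {(0, 0)} := by
  ext ⟨x, y⟩
  rw [circ_mem]
  simp only [Finset.mem_singleton, Prod.mk.injEq]
  constructor
  · exact sum_sq_zero p hp x y
  · rintro ⟨rfl, rfl⟩; simp

lemma circ_card_eq_one (p : ℕ) [Fact p.Prime] (i : ZMod p) (hi : i ≠ 0) :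
    (circ p i).card = (circ p 1).card := by
  obtain ⟨a, b, hab⟩ := ZMod.sq_add_sq p i
  symm
  refine Finset.card_bij' (fun z _ => (a * z.1 - b * z.2, a * z.2 + b * z.1))
    (fun w _ => ((a * w.1 + b * w.2) / i, (a * w.2 - b * w.1) / i)) ?_ ?_ ?_ ?_
  · rintro ⟨x, y⟩ h
    rw [circ_mem] at h ⊢
    simp only at h ⊢
    linear_combination (a ^ 2 + b ^ 2) * h + hab
  · rintro ⟨x, y⟩ h
    rw [circ_mem] at h ⊢
    simp only at h ⊢
    field_simp
    linear_combination (a ^ 2 + b ^ 2) * h + i * hab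
  · rintro ⟨x, y⟩ h
    simp only [Prod.mk.injEq]
    constructor <;> field_simp
    · linear_combination x * hab
    · linear_combination y * hab
  · rintro ⟨x, y⟩ h
    simp only [Prod.mk.injEq]
    constructor <;> field_simp
    · linear_combination x * hab
    · linear_combination y * hab

lemma circ_sum_card (p : ℕ) [Fact p.Prime] : ∑ i : ZMod p, (circ p i).card = p ^ 2 := by
  have := Finset.card_eq_sum_card_fiberwise (s := (Finset.univ : Finset (ZMod p × ZMod p)))
    (t := (Finset.univ : Finset (ZMod p))) (f := fun v => v.1 ^ 2 + v.2 ^ 2) (by simp)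
  simp only [Finset.card_univ, Fintype.card_prod, ZMod.card] at this
  rw [sq, this]
  rfl

lemma circ_card_one (p : ℕ) [Fact p.Prime] (hp : p % 4 = 3) : (circ p 1).card = p + 1 := by
  have h := circ_sum_card p
  rw [← Finset.add_sum_erase _ _ (Finset.mem_univ (0 : ZMod p)), circ_card_zero p hp,
    Finset.sum_congr rfl (g := fun _ => (circ p 1).card)
      (fun i hi => circ_card_eq_one p i (Finset.ne_of_mem_erase hi))] at h
  simp only [Finset.card_singleton, Finset.sum_const, smul_eq_mul,
    Finset.card_erase_of_mem (Finset.mem_univ (0 : ZMod p)), Finset.card_univ, ZMod.card] at h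
  obtain ⟨k, rfl⟩ : ∃ k, p = k + 2 := ⟨p - 2, by omega⟩
  have e : k + 2 - 1 = k + 1 := by omega
  rw [e] at h
  have : (k + 1) * (circ (k + 2) 1).card = (k + 1) * (k + 2 + 1) := by
    nlinarith
  exact Nat.eq_of_mul_eq_mul_left (by omega) this

lemma Ncirc_eq (p : ℕ) [NeZero p] (i k j : ZMod p) :
    Ncirc p i k j = ∑ a ∈ circ p i, ((circ p k).filter (fun b => a + b ∈ circ p j)).card := by
  unfold Ncirc
  simp only [Finset.card_filter, Finset.sum_product]

lemma fib_le (p : ℕ) [Fact p.Prime] (hp : p % 4 = 3) (i j : ZMod p) (hi : i ≠ 0)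
    (a : ZMod p × ZMod p) (ha : a ∈ circ p i) :
    ((circ p 1).filter (fun b => a + b ∈ circ p j)).card ≤ 2 := by
  have h2 : (2 : ZMod p) ≠ 0 := by
    have : ((2 : ℕ) : ZMod p) ≠ 0 := by
      rw [Ne, ZMod.natCast_eq_zero_iff]
      intro h
      have := Nat.le_of_dvd (by norm_num) h
      omega
    exact_mod_cast this
  obtain ⟨a1, a2⟩ := a
  rw [circ_mem] at ha
  simp only at ha
  set c : ZMod p := (j - i - 1) / 2 with hc
  have hc' : 2 * c = j - i - 1 := by rw [hc]; field_simp
  have key : ∀ b ∈ (circ p 1).filter (fun b => (a1, a2) + b ∈ circ p j),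
      a1 * b.1 + a2 * b.2 = c ∧ b.1 ^ 2 + b.2 ^ 2 = 1 := by
    rintro ⟨x, y⟩ h
    simp only [Finset.mem_filter, circ_mem, Prod.mk_add_mk] at h ⊢
    refine ⟨?_, h.1⟩
    apply mul_left_cancel₀ h2
    linear_combination h.2 - h.1 - ha - hc'
  calc _ ≤ (Polynomial.nthRoots 2 (i - c ^ 2)).toFinset.card := by
        apply Finset.card_le_card_of_injOn (fun b => a1 * b.2 - a2 * b.1)
        · intro b hb
          obtain ⟨h1, h3⟩ := key b hb
          simp only [Finset.mem_coe, Multiset.mem_toFinset]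
          rw [Polynomial.mem_nthRoots (by norm_num)]
          linear_combination (a1 ^ 2 + a2 ^ 2) * h3 + ha - (a1 * b.1 + a2 * b.2 + c) * h1
        · intro b hb d hd hbd
          obtain ⟨h1, -⟩ := key b hb
          obtain ⟨h3, -⟩ := key d hd
          simp only at hbd
          ext
          · apply mul_left_cancel₀ hi
            linear_combination a1 * h1 - a1 * h3 - a2 * hbd - (b.1 - d.1) * ha
          · apply mul_left_cancel₀ hi
            linear_combination a2 * h1 - a2 * h3 + a1 * hbd - (b.2 - d.2) * ha
    _ ≤ (Polynomial.nthRoots 2 (i - c ^ 2)).card := Multiset.toFinset_card_le _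
    _ ≤ 2 := Polynomial.card_nthRoots _ _

lemma N_le (p : ℕ) [Fact p.Prime] (hp : p % 4 = 3) (i j : ZMod p) (hi : i ≠ 0) :
    Ncirc p i 1 j ≤ 2 * (p + 1) := by
  rw [Ncirc_eq]
  calc _ ≤ ∑ a ∈ circ p i, 2 := Finset.sum_le_sum (fun a ha => fib_le p hp i j hi a ha)
    _ = 2 * (p + 1) := by
      rw [Finset.sum_const, circ_card_eq_one p i hi, circ_card_one p hp, smul_eq_mul, mul_comm]

lemma N_zero_left (p : ℕ) [Fact p.Prime] (hp : p % 4 = 3) (j : ZMod p) :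
    Ncirc p 0 1 j = if j = 1 then p + 1 else 0 := by
  rw [Ncirc_eq, circ_card_zero p hp, Finset.sum_singleton]
  split_ifs with h
  · subst h
    rw [← circ_card_one p hp]
    congr 1
    apply Finset.filter_true_of_mem
    rintro ⟨x, y⟩ h
    simpa using h
  · rw [Finset.card_eq_zero]
    apply Finset.filter_false_of_mem
    rintro ⟨x, y⟩ h1 h2
    simp only [Prod.mk_add_mk, zero_add, circ_mem] at h1 h2
    exact h (h2.symm.trans h1)

lemma N_zero_right (p : ℕ) [Fact p.Prime] (hp : p % 4 = 3) (i : ZMod p) :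
    Ncirc p i 1 0 = if i = 1 then p + 1 else 0 := by
  rw [Ncirc_eq, circ_card_zero p hp]
  have hf : ∀ a ∈ circ p i,
      ((circ p 1).filter (fun b => a + b ∈ ({(0, 0)} : Finset (ZMod p × ZMod p)))).card =
        if i = 1 then 1 else 0 := by
    rintro ⟨x, y⟩ ha
    rw [circ_mem] at ha
    simp only at ha
    split_ifs with h
    · rw [Finset.card_eq_one]
      refine ⟨(-x, -y), ?_⟩
      ext ⟨u, v⟩
      simp only [Finset.mem_filter, circ_mem, Prod.mk_add_mk, Finset.mem_singleton, Prod.mk.injEq]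
      constructor
      · rintro ⟨-, h1, h2⟩
        exact ⟨by linear_combination h1, by linear_combination h2⟩
      · rintro ⟨rfl, rfl⟩
        refine ⟨by linear_combination ha + h, by ring, by ring⟩
    · rw [Finset.card_eq_zero]
      apply Finset.filter_false_of_mem
      rintro ⟨u, v⟩ h1 h2
      simp only [Prod.mk_add_mk, circ_mem, Finset.mem_singleton, Prod.mk.injEq] at h1 h2
      apply h
      linear_combination h1 - ha + (x - u) * h2.1 + (y - v) * h2.2
  rw [Finset.sum_congr rfl hf]
  split_ifs with h
  · subst h; simp [circ_card_one p hp]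
  · simp

lemma circ_row_sum (p : ℕ) [Fact p.Prime] (i : ZMod p) :
    ∑ j, Ncirc p i 1 j = (circ p i).card * (circ p 1).card := by
  rw [← Finset.card_product, Finset.card_eq_sum_card_fiberwise
    (f := fun ab : (ZMod p × ZMod p) × (ZMod p × ZMod p) =>
      (ab.1 + ab.2).1 ^ 2 + (ab.1 + ab.2).2 ^ 2) (t := Finset.univ) (by simp)]
  simp only [Ncirc, circ_mem]

lemma circ_col_sum (p : ℕ) [Fact p.Prime] (j : ZMod p) :
    ∑ i, Ncirc p i 1 j = (circ p j).card * (circ p 1).card := by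
  rw [← Finset.card_product, Finset.card_eq_sum_card_fiberwise
    (f := fun cb : (ZMod p × ZMod p) × (ZMod p × ZMod p) =>
      (cb.1 - cb.2).1 ^ 2 + (cb.1 - cb.2).2 ^ 2) (t := Finset.univ) (by simp)]
  refine Finset.sum_congr rfl (fun i _ => ?_)
  refine Finset.card_bij' (fun ab _ => (ab.1 + ab.2, ab.2)) (fun cb _ => (cb.1 - cb.2, cb.2))
    ?_ ?_ ?_ ?_
  · rintro ⟨a, b⟩ h
    simp only [Finset.mem_filter, Finset.mem_product] at h ⊢
    refine ⟨⟨h.2, h.1.2⟩, ?_⟩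
    rw [add_sub_cancel_right]
    exact (circ_mem p i a).1 h.1.1
  · rintro ⟨a, b⟩ h
    simp only [Finset.mem_filter, Finset.mem_product] at h ⊢
    rw [sub_add_cancel, circ_mem p i]
    exact ⟨⟨h.2, h.1.2⟩, h.1.1⟩
  · rintro ⟨a, b⟩ h; simp
  · rintro ⟨a, b⟩ h; simp

/-- Abstract Hilbert-Schmidt estimate. -/
lemma hs_bound {ι : Type*} [Fintype ι] (m v : ι → ℝ) (K : ι → ι → ℝ) (α : ℝ)
    (hm : ∀ i, 0 < m i) (hv : v ≠ 0) (h : ∀ i, ∑ j, K i j * v j = α * (m i * v i)) :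
    α ^ 2 ≤ ∑ i, ∑ j, K i j ^ 2 / (m i * m j) := by
  set S := ∑ j, m j * v j ^ 2 with hS
  have hSpos : 0 < S := by
    obtain ⟨i, hi⟩ := Function.ne_iff.1 hv
    apply Finset.sum_pos' (fun j _ => mul_nonneg (hm j).le (sq_nonneg _))
    exact ⟨i, Finset.mem_univ _, mul_pos (hm i) (by positivity [show v i ≠ 0 from hi])⟩
  have row : ∀ i, α ^ 2 * (m i * v i ^ 2) ≤ (∑ j, K i j ^ 2 / (m i * m j)) * S := by
    intro i
    have cs := Finset.sum_sq_le_sum_mul_sum_of_sq_le_mul Finset.univ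
      (r := fun j => K i j * v j) (f := fun j => K i j ^ 2 / m j) (g := fun j => m j * v j ^ 2)
      (fun j _ => div_nonneg (sq_nonneg _) (hm j).le)
      (fun j _ => mul_nonneg (hm j).le (sq_nonneg _))
      (fun j _ => by have := (hm j).ne'; apply le_of_eq; field_simp)
    rw [h i, ← hS] at cs
    have e : ∑ j, K i j ^ 2 / (m i * m j) = (∑ j, K i j ^ 2 / m j) / m i := by
      rw [Finset.sum_div]
      refine Finset.sum_congr rfl (fun j _ => ?_)
      rw [div_div, mul_comm]
    rw [e, div_mul_eq_mul_div, le_div_iff₀ (hm i)]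
    calc _ = (α * (m i * v i)) ^ 2 := by ring
      _ ≤ _ := cs
  have tot := Finset.sum_le_sum (fun i (_ : i ∈ Finset.univ) => row i)
  rw [← Finset.mul_sum, ← Finset.sum_mul, ← hS] at tot
  exact le_of_mul_le_mul_right tot hSpos

/-- every real eigenvalue of `A` is at least `−1 + d/p`
for a universal constant `d > 0`. -/
theorem smallest_eigenvalue_bound :
    ∃ d : ℝ, 0 < d ∧ ∀ (p : ℕ) [Fact p.Prime], p % 4 = 3 →
      ∀ α : ℝ,
        (∃ v : ZMod p → ℝ, v ≠ 0 ∧ (kerA p).mulVec v = α • v) →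
        -1 + d / (p : ℝ) ≤ α := by
  refine ⟨1 / 2, by norm_num, ?_⟩
  intro p _ hp α ⟨v, hv, hA⟩
  have hp3 : (3 : ℝ) ≤ p := by
    have : 3 ≤ p := by omega
    exact_mod_cast this
  have hp0 : (p : ℝ) ≠ 0 := by positivity
  by_cases hα : 0 ≤ α
  · have : 1 / 2 / (p : ℝ) ≤ 1 := by
      rw [div_le_one (by positivity)]; linarith
    linarith
  push Not at hα
  have hone : (1 : ZMod p) ≠ 0 := one_ne_zero
  set q : ℝ := (p : ℝ) + 1 with hq
  have hqpos : 0 < q := by positivity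
  set m : ZMod p → ℝ := fun i => ((circ p i).card : ℝ) with hmdef
  set N : ZMod p → ZMod p → ℝ := fun i j => (Ncirc p i 1 j : ℝ) with hNdef
  have m0 : m 0 = 1 := by simp [hmdef, circ_card_zero p hp]
  have m1 : ∀ i, i ≠ 0 → m i = q := by
    intro i hi
    simp [hmdef, circ_card_eq_one p i hi, circ_card_one p hp, hq]
  have hm : ∀ i, 0 < m i := by
    intro i
    by_cases hi : i = 0
    · rw [hi, m0]; norm_num
    · rw [m1 i hi]; exact hqpos
  have hN0 : ∀ i j, 0 ≤ N i j := fun i j => Nat.cast_nonneg _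
  have msum : ∑ i, m i = (p : ℝ) ^ 2 := by
    have := circ_sum_card p
    simp only [hmdef]
    exact_mod_cast this
  have hrow : ∀ i, ∑ j, N i j = m i * q := by
    intro i
    have := circ_row_sum p i
    rw [← m1 1 hone]
    simp only [hmdef, hNdef]
    exact_mod_cast this
  have hcol : ∀ j, ∑ i, N i j = m j * q := by
    intro i
    have := circ_col_sum p i
    rw [← m1 1 hone]
    simp only [hmdef, hNdef]
    exact_mod_cast this
  have heig : ∀ i, ∑ j, N i j * v j = α * q * (m i * v i) := by
    intro i
    have h := congrFun hA i
    simp only [Matrix.mulVec, dotProduct, kerA, Pi.smul_apply, smul_eq_mul] at h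
    have e : ∑ j, N i j * v j = (m i * q) *
        ∑ j, (Ncirc p i 1 j : ℝ) / (((circ p i).card : ℝ) * ((circ p 1).card : ℝ)) * v j := by
      rw [Finset.mul_sum]
      refine Finset.sum_congr rfl (fun j _ => ?_)
      rw [← m1 1 hone]
      have h1 := (hm i).ne'
      have h2 := (hm 1).ne'
      simp only [hmdef, hNdef] at *
      field_simp
    rw [e, h]; ring
  have horth : ∑ j, m j * v j = 0 := by
    have e : ∑ i, ∑ j, N i j * v j = q * ∑ j, m j * v j := by
      rw [Finset.sum_comm, Finset.mul_sum]
      refine Finset.sum_congr rfl (fun j _ => ?_)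
      rw [← Finset.sum_mul, hcol]; ring
    rw [Finset.sum_congr rfl (fun i _ => heig i), ← Finset.mul_sum] at e
    have : q * (1 - α) * ∑ j, m j * v j = 0 := by linear_combination -e
    rcases mul_eq_zero.1 this with h | h
    · exact absurd h (mul_ne_zero hqpos.ne' (by linarith))
    · exact h
  have hs := hs_bound m v (fun i j => N i j - q / (p : ℝ) ^ 2 * (m i * m j)) (α * q) hm hv (by
    intro i
    have : ∀ j, (N i j - q / (p : ℝ) ^ 2 * (m i * m j)) * v j
        = N i j * v j - q / (p : ℝ) ^ 2 * m i * (m j * v j) := fun j => by ring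
    simp only [this]
    rw [Finset.sum_sub_distrib, ← Finset.mul_sum, horth, heig i]; ring)
  have term : ∀ i j, N i j ^ 2 / (m i * m j) ≤ 2 / q * N i j +
      (if i = 0 then (if j = 1 then q - 2 else 0) else 0) +
      (if j = 0 then (if i = 1 then q - 2 else 0) else 0) := by
    intro i j
    by_cases hi : i = 0
    · subst hi
      have hN : N 0 j = if j = 1 then q else 0 := by
        simp only [hNdef, N_zero_left p hp j, hq]; split_ifs <;> simp
      rw [hN]
      by_cases hj : j = 1
      · subst hj
        simp only [hone, hone.symm, if_true, if_false, m0, m1 1 hone]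
        apply le_of_eq; field_simp; ring
      · simp [hj, hone.symm]
    · by_cases hj : j = 0
      · subst hj
        have hN : N i 0 = if i = 1 then q else 0 := by
          simp only [hNdef, N_zero_right p hp i, hq]; split_ifs <;> simp
        rw [hN]
        by_cases hj : i = 1
        · subst hj
          simp only [hone, hone.symm, if_true, if_false, m0, m1 1 hone]
          apply le_of_eq; field_simp; ring
        · simp [hj, hone.symm]
      · simp only [hi, hj, if_false, add_zero, m1 i hi, m1 j hj]
        have hle : N i j ≤ 2 * q := by
          have := N_le p hp i j hi
          simp only [hNdef, hq]
          exact_mod_cast this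
        rw [div_le_iff₀ (by positivity)]
        have e : 2 / q * N i j * (q * q) = 2 * q * N i j := by field_simp
        rw [e]
        nlinarith [hN0 i j]
  have Nsum : ∑ i, ∑ j, N i j = (p : ℝ) ^ 2 * q := by
    simp only [hrow]
    rw [← Finset.sum_mul, msum]
  have t1 : ∑ i, ∑ j, N i j ^ 2 / (m i * m j) ≤ 2 * (p : ℝ) ^ 2 + 2 * (q - 2) := by
    calc _ ≤ ∑ i, ∑ j, (2 / q * N i j +
      (if i = 0 then (if j = 1 then q - 2 else 0) else 0) +
      (if j = 0 then (if i = 1 then q - 2 else 0) else 0)) :=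
          Finset.sum_le_sum (fun i _ => Finset.sum_le_sum (fun j _ => term i j))
      _ = 2 / q * (∑ i, ∑ j, N i j) + (q - 2) + (q - 2) := by
          simp only [Finset.sum_add_distrib, ← Finset.mul_sum]
          congr 1
          · congr 1
            rw [Finset.sum_eq_single 0] <;> simp +contextual
          · simp
      _ = _ := by rw [Nsum]; field_simp; ring
  have t2 : ∑ i, ∑ j, (N i j - q / (p : ℝ) ^ 2 * (m i * m j)) ^ 2 / (m i * m j)
      = (∑ i, ∑ j, N i j ^ 2 / (m i * m j)) - q ^ 2 := by
    have : ∀ i j, (N i j - q / (p : ℝ) ^ 2 * (m i * m j)) ^ 2 / (m i * m j)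
        = N i j ^ 2 / (m i * m j) - 2 * q / (p : ℝ) ^ 2 * N i j
          + (q / (p : ℝ) ^ 2) ^ 2 * (m i * m j) := by
      intro i j
      have h1 := (hm i).ne'
      have h2 := (hm j).ne'
      field_simp
      ring
    simp only [this, Finset.sum_add_distrib, Finset.sum_sub_distrib, ← Finset.mul_sum, Nsum,
      ← Finset.sum_mul, msum]
    field_simp
    ring
  rw [t2] at hs
  have hfin : (α * q) ^ 2 ≤ (p : ℝ) ^ 2 := by
    have : q ^ 2 = (p : ℝ) ^ 2 + 2 * p + 1 := by rw [hq]; ring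
    linarith
  have hlow : -(p : ℝ) ≤ α * q := (abs_le_of_sq_le_sq' hfin (by positivity)).1
  have h3 : -1 + 1 / q ≤ α := by
    have : -1 + 1 / q = -(p : ℝ) / q := by
      field_simp; rw [hq]; ring
    rw [this, div_le_iff₀ hqpos]; exact hlow
  have h4 : 1 / 2 / (p : ℝ) ≤ 1 / q := by
    rw [div_div]
    apply one_div_le_one_div_of_le hqpos
    rw [hq]; linarith
  linarith
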